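/- Let $p$ be a prime and let $\alpha, \beta \in \mathbb{C}$ with $|\alpha| = |\beta| = 1$ and $\alpha^2 \neq 1$. Then the doubly infinite series below converges absolutely and $$\frac{1}{1+p^{-1}} \sum_{m \in \mathbb{Z}} p^{-|m|/2}\, \beta^{m} \left( \alpha^{|m|}\, \frac{1 - p^{-1}\alpha^{-2}}{1 - \alpha^{-2}} + \alpha^{-|m|}\, \frac{1 - p^{-1}\alpha^{2}}{1 - \alpha^{2}} \right) = \frac{(1-p^{-1})^{2}\,(1-\alpha^{2}p^{-1})(1-\alpha^{-2}p^{-1})}{(1-p^{-2})} \prod_{\epsilon \in \{1,-1\}} \prod_{\delta \in \{1,-1\}} \left(1 - \alpha^{\epsilon}\beta^{\delta} p^{-1/2}\right)^{-1}.$$ -/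

import Mathlib

theorem hasSum_aux (y b : ℂ) (hy : ‖y‖ < 1) (hb : ‖b‖ = 1) :
    HasSum (fun m : ℤ => y ^ m.natAbs * b ^ m)
      ((1 - y ^ 2) / ((1 - y * b) * (1 - y * b⁻¹))) := by
  have hb0 : b ≠ 0 := by
    rintro rfl
    simp at hb
  have h1 : ‖y * b‖ < 1 := by simpa [hb] using hy
  have h2 : ‖y * b⁻¹‖ < 1 := by simpa [hb] using hy
  have n1 : 1 - y * b ≠ 0 := by
    intro h
    rw [← sub_eq_zero.mp h] at h1
    simp at h1
  have n2 : 1 - y * b⁻¹ ≠ 0 := by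
    intro h
    rw [← sub_eq_zero.mp h] at h2
    simp at h2
  have s1 := hasSum_geometric_of_norm_lt_one h1
  have s2 := (hasSum_geometric_of_norm_lt_one h2).mul_left (y * b⁻¹)
  have key := HasSum.of_nat_of_neg_add_one (f := fun m : ℤ => y ^ m.natAbs * b ^ m)
    (m := (1 - y * b)⁻¹) (m' := y * b⁻¹ * (1 - y * b⁻¹)⁻¹)
    (by
      refine s1.congr_fun (fun n => ?_)
      simp [mul_pow])
    (by
      refine s2.congr_fun (fun n => ?_)
      have e : (-((n : ℤ) + 1)).natAbs = n + 1 := by omega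
      rw [e, zpow_neg, ← inv_zpow, ← pow_succ', mul_pow]
      norm_cast)
  convert key using 1
  rw [div_eq_iff (mul_ne_zero n1 n2)]
  have e : ((1 - y * b)⁻¹ + y * b⁻¹ * (1 - y * b⁻¹)⁻¹) * ((1 - y * b) * (1 - y * b⁻¹))
    = (1 - y * b) * (1 - y * b)⁻¹ * (1 - y * b⁻¹)
      + y * b⁻¹ * (1 - y * b) * ((1 - y * b⁻¹) * (1 - y * b⁻¹)⁻¹) := by ring
  rw [e, mul_inv_cancel₀ n1, mul_inv_cancel₀ n2]
  linear_combination (y ^ 2) * (mul_inv_cancel₀ hb0)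

theorem ne_aux (z : ℂ) (h : ‖z‖ < 1) : 1 - z ≠ 0 := by
  intro h0
  rw [← sub_eq_zero.mp h0] at h
  simp at h

/-- **The local toral integral computation at a split prime with unramified character**
(proof of Proposition 3.3, split case, `i_p(χ) = 0`).
For a prime `p` and `α, β ∈ ℂ` with `|α| = |β| = 1` and `α² ≠ 1`, the doubly infinite
series (Macdonald's formula summed against `β^m`) converges absolutely and
`(1+p⁻¹)⁻¹ ∑_{m ∈ ℤ} p^{-|m|/2} β^m (α^{|m|}(1-p⁻¹α⁻²)/(1-α⁻²) + α^{-|m|}(1-p⁻¹α²)/(1-α²))`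
equals
`(1-p⁻¹)²(1-α²p⁻¹)(1-α⁻²p⁻¹)/(1-p⁻²) · ∏_{ε,δ ∈ {±1}} (1-α^ε β^δ p^{-1/2})⁻¹`. -/
theorem split_toral_integral (p : ℕ) (hp : p.Prime) (α β : ℂ)
    (hα : ‖α‖ = 1) (hβ : ‖β‖ = 1) (hα2 : α ^ 2 ≠ 1) :
    Summable (fun m : ℤ =>
      ((Real.sqrt p : ℂ))⁻¹ ^ m.natAbs * β ^ m *
        (α ^ m.natAbs * ((1 - (p : ℂ)⁻¹ * α⁻¹ ^ 2) / (1 - α⁻¹ ^ 2)) +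
         α⁻¹ ^ m.natAbs * ((1 - (p : ℂ)⁻¹ * α ^ 2) / (1 - α ^ 2)))) ∧
    (1 + (p : ℂ)⁻¹)⁻¹ *
        (∑' m : ℤ,
          ((Real.sqrt p : ℂ))⁻¹ ^ m.natAbs * β ^ m *
            (α ^ m.natAbs * ((1 - (p : ℂ)⁻¹ * α⁻¹ ^ 2) / (1 - α⁻¹ ^ 2)) +
             α⁻¹ ^ m.natAbs * ((1 - (p : ℂ)⁻¹ * α ^ 2) / (1 - α ^ 2))))
      = ((1 - (p : ℂ)⁻¹) ^ 2 * (1 - α ^ 2 * (p : ℂ)⁻¹) * (1 - α⁻¹ ^ 2 * (p : ℂ)⁻¹) /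
          (1 - ((p : ℂ)⁻¹) ^ 2)) *
        ∏ ε ∈ ({1, -1} : Finset ℤ), ∏ δ ∈ ({1, -1} : Finset ℤ),
          (1 - α ^ ε * β ^ δ * (Real.sqrt p : ℂ)⁻¹)⁻¹ := by
  have hp2 : (2 : ℝ) ≤ p := by exact_mod_cast hp.two_le
  have hx : ‖((Real.sqrt p : ℂ))⁻¹‖ < 1 := by
    rw [norm_inv, Complex.norm_real, Real.norm_of_nonneg (Real.sqrt_nonneg _)]
    apply inv_lt_one_of_one_lt₀
    rw [Real.lt_sqrt] <;> linarith
  have hpx : (p : ℂ)⁻¹ = ((Real.sqrt p : ℂ))⁻¹ ^ 2 := by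
    rw [inv_pow]
    congr 1
    rw [← Complex.ofReal_pow, Real.sq_sqrt (by linarith)]
    simp
  rw [hpx]
  generalize ((Real.sqrt p : ℂ))⁻¹ = x at *
  have hα0 : α ≠ 0 := by
    rintro rfl
    simp at hα
  have hβ0 : β ≠ 0 := by
    rintro rfl
    simp at hβ
  have A := hasSum_aux (x * α) β (by simpa [hα] using hx) hβ
  have B := hasSum_aux (x * α⁻¹) β (by simpa [hα] using hx) hβ
  have S := (A.mul_right ((1 - x ^ 2 * α⁻¹ ^ 2) / (1 - α⁻¹ ^ 2))).add
    (B.mul_right ((1 - x ^ 2 * α ^ 2) / (1 - α ^ 2)))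
  have S' := S.congr_fun (g := (fun m : ℤ =>
      x ^ m.natAbs * β ^ m *
        (α ^ m.natAbs * ((1 - x ^ 2 * α⁻¹ ^ 2) / (1 - α⁻¹ ^ 2)) +
         α⁻¹ ^ m.natAbs * ((1 - x ^ 2 * α ^ 2) / (1 - α ^ 2))))) 
      (fun m => by simp only [mul_pow]; ring)
  refine ⟨S'.summable, ?_⟩
  rw [S'.tsum_eq]
  have hx2 : ‖x ^ 2‖ < 1 := by
    rw [norm_pow]
    exact pow_lt_one₀ (norm_nonneg _) hx (by norm_num)
  have m1 : 1 - x ^ 2 ≠ 0 := ne_aux _ hx2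
  have m2 : 1 + x ^ 2 ≠ 0 := by
    have := ne_aux (-x ^ 2) (by simpa using hx2)
    simpa using this
  have n1 : 1 - x * α * β ≠ 0 := ne_aux _ (by simpa [hα, hβ] using hx)
  have n2 : 1 - x * α * β⁻¹ ≠ 0 := ne_aux _ (by simpa [hα, hβ] using hx)
  have n3 : 1 - x * α⁻¹ * β ≠ 0 := ne_aux _ (by simpa [hα, hβ] using hx)
  have n4 : 1 - x * α⁻¹ * β⁻¹ ≠ 0 := ne_aux _ (by simpa [hα, hβ] using hx)
  have k1 : 1 - α ^ 2 ≠ 0 := sub_ne_zero.mpr (Ne.symm hα2)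
  have k2 : 1 - α⁻¹ ^ 2 ≠ 0 := by
    intro h
    apply hα2
    have := sub_eq_zero.mp h
    rw [inv_pow] at this
    exact inv_eq_one.mp this.symm
  have hne : (1 : ℤ) ∉ ({-1} : Finset ℤ) := by decide
  simp only [Finset.prod_insert hne, Finset.prod_singleton, zpow_one, zpow_neg_one]
  rw [show α * β * x = x * α * β by ring, show α * β⁻¹ * x = x * α * β⁻¹ by ring,
    show α⁻¹ * β * x = x * α⁻¹ * β by ring, show α⁻¹ * β⁻¹ * x = x * α⁻¹ * β⁻¹ by ring]
  have m3 : 1 - (x ^ 2) ^ 2 ≠ 0 := by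
    rw [show 1 - (x ^ 2) ^ 2 = (1 - x ^ 2) * (1 + x ^ 2) by ring]
    exact mul_ne_zero m1 m2
  have ha : α * α⁻¹ = 1 := mul_inv_cancel₀ hα0
  have hb : β * β⁻¹ = 1 := mul_inv_cancel₀ hβ0
  generalize α⁻¹ = a at *
  generalize β⁻¹ = b at *
  have core : ((1 - x * a * β) * (1 - x * a * b)) / (1 - a ^ 2)
      + ((1 - x * α * β) * (1 - x * α * b)) / (1 - α ^ 2) = 1 - x ^ 2 := by
    rw [div_add_div _ _ k2 k1, div_eq_iff (mul_ne_zero k2 k1)]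
    obtain rfl : a = α⁻¹ := eq_inv_of_mul_eq_one_right ha
    obtain rfl : b = β⁻¹ := eq_inv_of_mul_eq_one_right hb
    field_simp
    ring
  have m4 : (1 - x ^ 2) ^ 2 / (1 - (x ^ 2) ^ 2) = (1 + x ^ 2)⁻¹ * (1 - x ^ 2) := by
    rw [div_eq_iff m3]
    linear_combination (-(1 - x ^ 2) ^ 2) * (inv_mul_cancel₀ m2)
  calc _ = (1 + x ^ 2)⁻¹ * ((1 - α ^ 2 * x ^ 2) * (1 - a ^ 2 * x ^ 2)
        * (((1 - x * a * β) * (1 - x * a * b)) / (1 - a ^ 2)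
      + ((1 - x * α * β) * (1 - x * α * b)) / (1 - α ^ 2))
        * ((1 - x * α * β)⁻¹ * (1 - x * α * b)⁻¹ * ((1 - x * a * β)⁻¹ * (1 - x * a * b)⁻¹))) := by
        congr 1
        generalize 1 - x * α * β = N1 at *
        generalize 1 - x * α * b = N2 at *
        generalize 1 - x * a * β = N3 at *
        generalize 1 - x * a * b = N4 at *
        generalize 1 - a ^ 2 = K2 at *
        generalize 1 - α ^ 2 = K1 at *
        field_simp
    _ = _ := by
        rw [core]
        linear_combination (-(1 - α ^ 2 * x ^ 2) * (1 - a ^ 2 * x ^ 2)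
          * ((1 - x * α * β)⁻¹ * (1 - x * α * b)⁻¹ *
            ((1 - x * a * β)⁻¹ * (1 - x * a * b)⁻¹))) * m4
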